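/- arXiv:2109.03686 — 4 statements merged into one kernel-verified Lean document; each statement's English description precedes it below -/
import Mathlib

section
/- Let Ω ⊆ ℝⁿ be open, n ≥ 2, and let u : Ω → ℝ be a smooth function with |Du(x)| < 1 for all x ∈ Ω. Suppose the graph of u is simultaneously minimal and maximal, i.e. div(Du/√(1+|Du|²)) = 0 and div(Du/√(1−|Du|²)) = 0 on Ω. Then every level set of u is a minimal hypersurface of ℝⁿ: at every point x ∈ Ω with Du(x) ≠ 0 one has div(Du/|Du|)(x) = 0, equivalently |Du(x)|² Δu(x) − D²u(x)(Du(x),Du(x)) = 0, so the mean curvature of the level hypersurface {u = u(x)} ⊆ ℝⁿ vanishes at x. -/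
open scoped RealInnerProductSpace

/-- Divergence of a vector field on ℝⁿ. -/
noncomputable def vdiv {n : ℕ} (X : EuclideanSpace ℝ (Fin n) → EuclideanSpace ℝ (Fin n))
    (x : EuclideanSpace ℝ (Fin n)) : ℝ :=
  ∑ i, ⟪fderiv ℝ X x (EuclideanSpace.single i 1), EuclideanSpace.single i 1⟫

/-- Hessian bilinear form `D²u(x)(v,w)` of a function on ℝⁿ. -/
noncomputable def hess {n : ℕ} (u : EuclideanSpace ℝ (Fin n) → ℝ)
    (x v w : EuclideanSpace ℝ (Fin n)) : ℝ :=
  ⟪fderiv ℝ (gradient u) x v, w⟫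

/-- The Lorentz–Minkowski inner product on ℝⁿ × ℝ = 𝕃^{n+1}. -/
noncomputable def linner {n : ℕ} (p q : EuclideanSpace ℝ (Fin n) × ℝ) : ℝ :=
  ⟪p.1, q.1⟫ - p.2 * q.2
lemma vdiv_eq_sum_of_hasFDerivAt {n : ℕ}
    {X : EuclideanSpace ℝ (Fin n) → EuclideanSpace ℝ (Fin n)}
    {X' : EuclideanSpace ℝ (Fin n) →L[ℝ] EuclideanSpace ℝ (Fin n)}
    {x : EuclideanSpace ℝ (Fin n)} (h : HasFDerivAt X X' x) :
    vdiv X x = ∑ i, X' (EuclideanSpace.single i 1) i := by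
  simp [vdiv, h.fderiv, EuclideanSpace.inner_single_right]

/-- Product rule for the divergence of a vector field rescaled by a function of its squared norm. -/
lemma vdiv_comp_norm_sq_smul {n : ℕ}
    {G : EuclideanSpace ℝ (Fin n) → EuclideanSpace ℝ (Fin n)}
    {x : EuclideanSpace ℝ (Fin n)} (hG : DifferentiableAt ℝ G x) {φ : ℝ → ℝ} {φ' : ℝ}
    (hφ : HasDerivAt φ φ' (‖G x‖ ^ 2)) :
    vdiv (fun y => φ (‖G y‖ ^ 2) • G y) x =
      φ (‖G x‖ ^ 2) * vdiv G x + 2 * φ' * ⟪fderiv ℝ G x (G x), G x⟫ := by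
  have hG' := hG.hasFDerivAt
  have h := (hφ.comp_hasFDerivAt x hG'.norm_sq).smul hG'
  have hexp : fderiv ℝ G x (G x) = ∑ i, G x i • fderiv ℝ G x (EuclideanSpace.single i 1) := by
    have hx : G x = ∑ i, G x i • EuclideanSpace.single i (1 : ℝ) := by
      simpa using ((EuclideanSpace.basisFun (Fin n) ℝ).sum_repr (G x)).symm
    conv_lhs => rw [hx, map_sum]
    simp
  have h1 : vdiv (fun y => φ (‖G y‖ ^ 2) • G y) x = _ := vdiv_eq_sum_of_hasFDerivAt h
  rw [h1, vdiv_eq_sum_of_hasFDerivAt hG', hexp, sum_inner, Finset.mul_sum, Finset.mul_sum,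
    ← Finset.sum_add_distrib]
  refine Finset.sum_congr rfl fun i _ => ?_
  rw [real_inner_smul_left, real_inner_comm (G x)]
  simp
  ring

lemma ContDiffAt.differentiableAt_gradient {n : ℕ} {u : EuclideanSpace ℝ (Fin n) → ℝ}
    {x : EuclideanSpace ℝ (Fin n)} (hu : ContDiffAt ℝ 2 u x) :
    DifferentiableAt ℝ (gradient u) x := by
  have h : DifferentiableAt ℝ (fderiv ℝ u) x :=
    (hu.fderiv_right (m := 1) (by norm_num)).differentiableAt (by norm_num)
  exact (InnerProductSpace.toDual ℝ (EuclideanSpace ℝ (Fin n))).symm.differentiableAt.comp x h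

/-- Level sets of a simultaneously minimal and maximal spacelike graph are
minimal hypersurfaces of ℝⁿ. -/
theorem level_sets_minimal {n : ℕ} (hn : 2 ≤ n)
    (Ω : Set (EuclideanSpace ℝ (Fin n))) (hΩ : IsOpen Ω)
    (u : EuclideanSpace ℝ (Fin n) → ℝ) (hu : ContDiffOn ℝ (⊤ : ℕ∞) u Ω)
    (hsp : ∀ x ∈ Ω, ‖gradient u x‖ < 1)
    (hmin : ∀ x ∈ Ω,
      vdiv (fun y => (Real.sqrt (1 + ‖gradient u y‖ ^ 2))⁻¹ • gradient u y) x = 0)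
    (hmax : ∀ x ∈ Ω,
      vdiv (fun y => (Real.sqrt (1 - ‖gradient u y‖ ^ 2))⁻¹ • gradient u y) x = 0) :
    ∀ x ∈ Ω, gradient u x ≠ 0 →
      vdiv (fun y => ‖gradient u y‖⁻¹ • gradient u y) x = 0 ∧
      ‖gradient u x‖ ^ 2 * vdiv (gradient u) x
        - hess u x (gradient u x) (gradient u x) = 0 := by
  intro x hx hne
  have hG : DifferentiableAt ℝ (gradient u) x :=
    ((hu.contDiffAt (hΩ.mem_nhds hx)).of_le 
      (WithTop.coe_le_coe.2 (le_top : (2 : ℕ∞) ≤ ⊤))).differentiableAt_gradient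
  have hs : ‖gradient u x‖ ^ 2 < 1 := by
    have := hsp x hx
    have := norm_nonneg (gradient u x)
    nlinarith
  have hs0 : 0 < ‖gradient u x‖ ^ 2 := by positivity
  have ha : 0 < 1 + ‖gradient u x‖ ^ 2 := by linarith
  have hb : 0 < 1 - ‖gradient u x‖ ^ 2 := by linarith
  have d1 := vdiv_comp_norm_sq_smul hG
    ((((hasDerivAt_id' (‖gradient u x‖ ^ 2)).const_add 1).sqrt ha.ne').fun_inv
      (Real.sqrt_pos.2 ha).ne')
  have d2 := vdiv_comp_norm_sq_smul hG
    ((((hasDerivAt_id' (‖gradient u x‖ ^ 2)).const_sub 1).sqrt hb.ne').fun_inv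
      (Real.sqrt_pos.2 hb).ne')
  have d3 := vdiv_comp_norm_sq_smul hG
    (((hasDerivAt_id' (‖gradient u x‖ ^ 2)).sqrt hs0.ne').fun_inv (Real.sqrt_pos.2 hs0).ne')
  rw [hmin x hx] at d1
  rw [hmax x hx] at d2
  simp only [Real.sqrt_sq (norm_nonneg _)] at d3
  have ra := Real.sq_sqrt ha.le
  have rb := Real.sq_sqrt hb.le
  have pa := Real.sqrt_pos.2 ha
  have pb := Real.sqrt_pos.2 hb
  set a := √(1 + ‖gradient u x‖ ^ 2)
  set b := √(1 - ‖gradient u x‖ ^ 2)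
  set L := vdiv (gradient u) x
  set H := ⟪fderiv ℝ (gradient u) x (gradient u x), gradient u x⟫ with hH
  have e1 : a ^ 2 * L - H = 0 := by
    field_simp at d1
    linarith
  have e2 : b ^ 2 * L + H = 0 := by
    field_simp at d2
    linarith
  rw [ra] at e1
  rw [rb] at e2
  have hL : L = 0 := by linarith
  have hH0 : H = 0 := by simpa [hL] using e2
  constructor
  · rw [d3, hL, hH0]
    ring
  · rw [hess, ← hH, hL, hH0]
    ring
end

section
/- Let Ω ⊆ ℝⁿ be open, n ≥ 2, and let u : Ω → ℝ be a smooth function with |Du(x)| < 1 for all x ∈ Ω. If div(Du/√(1+|Du|²)) = 0 and div(Du/√(1−|Du|²)) = 0 on Ω, then u is harmonic on all of Ω: Δu(x) = 0 for every x ∈ Ω (including points where Du vanishes). -/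
open scoped RealInnerProductSpace

/-- The divergence of `X / √(1 + ε‖X‖²)`, cleared of denominators. -/
theorem vdiv_inv_sqrt_smul {n : ℕ} {X : EuclideanSpace ℝ (Fin n) → EuclideanSpace ℝ (Fin n)}
    {x : EuclideanSpace ℝ (Fin n)} (hX : DifferentiableAt ℝ X x) (ε : ℝ)
    (hpos : 0 < 1 + ε * ‖X x‖ ^ 2) :
    Real.sqrt (1 + ε * ‖X x‖ ^ 2) ^ 3 *
        vdiv (fun y => (Real.sqrt (1 + ε * ‖X y‖ ^ 2))⁻¹ • X y) x =
      (1 + ε * ‖X x‖ ^ 2) * vdiv X x - ε * ⟪X x, fderiv ℝ X x (X x)⟫ := by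
  have hsqrt : 0 < Real.sqrt (1 + ε * ‖X x‖ ^ 2) := Real.sqrt_pos.mpr hpos
  have hsq : Real.sqrt (1 + ε * ‖X x‖ ^ 2) ^ 2 = 1 + ε * ‖X x‖ ^ 2 := Real.sq_sqrt hpos.le
  have hd := ((hasDerivAt_inv hsqrt.ne').comp_hasFDerivAt x
    (((hX.hasFDerivAt.norm_sq.const_mul ε).const_add 1).sqrt hpos.ne')).fun_smul hX.hasFDerivAt
  have hexp : fderiv ℝ X x (X x) =
      ∑ i, X x i • fderiv ℝ X x (EuclideanSpace.single i 1) := by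
    conv_lhs => rw [← (EuclideanSpace.basisFun (Fin n) ℝ).sum_repr (X x)]
    simp [map_sum]
  simp only [Function.comp_apply] at hd
  rw [hexp, inner_sum, vdiv, vdiv, hd.fderiv, Finset.mul_sum, Finset.mul_sum, Finset.mul_sum,
    ← Finset.sum_sub_distrib]
  refine Finset.sum_congr rfl fun i _ => ?_
  rw [← hsq]
  simp [inner_add_left, inner_smul_left, inner_smul_right, EuclideanSpace.inner_single_right]
  field_simp
  ring

/-- A simultaneously minimal and maximal spacelike graph has harmonic defining
function. -/
theorem harmonic_of_minimal_and_maximal {n : ℕ} (hn : 2 ≤ n)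
    (Ω : Set (EuclideanSpace ℝ (Fin n))) (hΩ : IsOpen Ω)
    (u : EuclideanSpace ℝ (Fin n) → ℝ) (hu : ContDiffOn ℝ (⊤ : ℕ∞) u Ω)
    (hsp : ∀ x ∈ Ω, ‖gradient u x‖ < 1)
    (hmin : ∀ x ∈ Ω,
      vdiv (fun y => (Real.sqrt (1 + ‖gradient u y‖ ^ 2))⁻¹ • gradient u y) x = 0)
    (hmax : ∀ x ∈ Ω,
      vdiv (fun y => (Real.sqrt (1 - ‖gradient u y‖ ^ 2))⁻¹ • gradient u y) x = 0) :
    ∀ x ∈ Ω, vdiv (gradient u) x = 0 := by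
  intro x hx
  have hΩx : Ω ∈ nhds x := hΩ.mem_nhds hx
  have hgrad : DifferentiableAt ℝ (gradient u) x :=
    (InnerProductSpace.toDual ℝ (EuclideanSpace ℝ (Fin n))).symm.toContinuousLinearEquiv
      |>.differentiableAt.comp x
        (((hu.contDiffAt hΩx).fderiv_right (m := 1) (by norm_cast)).differentiableAt
          one_ne_zero)
  have hlt : ‖gradient u x‖ ^ 2 < 1 := by
    have := hsp x hx
    nlinarith [norm_nonneg (gradient u x)]
  have hplus := vdiv_inv_sqrt_smul hgrad 1 (by positivity)
  have hminus := vdiv_inv_sqrt_smul hgrad (-1) (by linarith)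
  simp only [one_mul, neg_one_mul, ← sub_eq_add_neg, hmin x hx, hmax x hx, mul_zero]
    at hplus hminus
  linarith
end

section
/- Let u : ℝⁿ → ℝ, n ≥ 2, be a smooth function with |Du(x)| < 1 for all x ∈ ℝⁿ, whose entire graph is simultaneously minimal in ℝ^{n+1} and maximal in 𝕃^{n+1}, i.e. div(Du/√(1+|Du|²)) = 0 and div(Du/√(1−|Du|²)) = 0 on all of ℝⁿ. Then the graph of u is a spacelike hyperplane: u is an affine function, u(x) = ⟨a, x⟩ + b for some a ∈ ℝⁿ with |a| < 1 and b ∈ ℝ. -/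
open scoped RealInnerProductSpace

open InnerProductSpace Laplacian Topology

/-- At a local maximum the second derivative of a continuous function is nonpositive. -/
theorem IsLocalMax.deriv_deriv_nonpos {h : ℝ → ℝ} {x : ℝ} (hmax : IsLocalMax h x)
    (hc : ContinuousAt h x) : deriv (deriv h) x ≤ 0 := by
  by_contra! hpos
  have hmin := isLocalMin_of_deriv_deriv_pos hpos hmax.deriv_eq_zero hc
  have hconst : h =ᶠ[𝓝 x] fun _ => h x := by
    filter_upwards [hmax, hmin] with y h₁ h₂ using le_antisymm h₁ h₂
  have hderiv : deriv h =ᶠ[𝓝 x] fun _ => 0 := by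
    simpa using hconst.deriv
  rw [hderiv.deriv_eq] at hpos
  simp at hpos

section Liouville

variable {E : Type*} [NormedAddCommGroup E] [InnerProductSpace ℝ E]

/-- If `f` minus a quadratic polynomial has a local maximum along a line, then the second derivative
of `f` along this line is at most that of the polynomial. -/
theorem iteratedFDeriv_two_le_of_isLocalMax_line {f : E → ℝ} (hf : ContDiff ℝ 2 f) (x v : E)
    (α β : ℝ) (hmax : IsLocalMax (fun t : ℝ => f (x + t • v) - (α * t + β * t ^ 2)) 0) :
    iteratedFDeriv ℝ 2 f x ![v, v] ≤ 2 * β := by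
  have hline (t : ℝ) : HasDerivAt (fun s : ℝ => x + s • v) v t := by
    simpa using ((hasDerivAt_id t).smul_const v).const_add x
  have h₁ (t : ℝ) : HasDerivAt (fun t : ℝ => f (x + t • v) - (α * t + β * t ^ 2))
      (fderiv ℝ f (x + t • v) v - (α + 2 * β * t)) t := by
    have hd := ((hf.differentiable (by norm_num)) (x + t • v)).hasFDerivAt.comp_hasDerivAt t (hline t)
    have hq := ((hasDerivAt_id t).const_mul α).add (((hasDerivAt_id t).pow 2).const_mul β)
    refine (hd.sub hq).congr_deriv ?_
    simp
    ring
  have h₂ : HasDerivAt (fun t : ℝ => fderiv ℝ f (x + t • v) v - (α + 2 * β * t))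
      (iteratedFDeriv ℝ 2 f x ![v, v] - 2 * β) 0 := by
    have hf' : Differentiable ℝ (fderiv ℝ f) :=
      (hf.fderiv_right (m := 1) (by norm_num)).differentiable (by norm_num)
    have hd : HasDerivAt (fun t : ℝ => fderiv ℝ f (x + t • v)) (fderiv ℝ (fderiv ℝ f) x v) 0 :=
      HasFDerivAt.comp_hasDerivAt (f := fun t : ℝ => x + t • v) 0
        (by simpa using (hf' x).hasFDerivAt) (hline 0)
    have hd' := hd.clm_apply (hasDerivAt_const (0 : ℝ) v)
    have hq : HasDerivAt (fun t : ℝ => α + 2 * β * t) (2 * β) 0 := by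
      simpa using ((hasDerivAt_id (0 : ℝ)).const_mul (2 * β)).const_add α
    exact (hd'.sub hq).congr_deriv (by simp [iteratedFDeriv_two_apply])
  have h := hmax.deriv_deriv_nonpos (h₁ 0).continuousAt
  rw [funext fun t => (h₁ t).deriv, h₂.deriv] at h
  linarith

variable [FiniteDimensional ℝ E]

/-- Barrier estimate on a half ball for bounded harmonic functions vanishing on a hyperplane. -/
theorem le_barrier_of_laplacian_eq_zero {w : E → ℝ} (hw : ContDiff ℝ 2 w) (hΔ : ∀ x, Δ w x = 0)
    {M : ℝ} (hM : 0 < M) (hbd : ∀ x, w x ≤ M) {e : E} (he : ‖e‖ = 1)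
    (h0 : ∀ x, ⟪e, x⟫ = 0 → w x = 0) {R : ℝ} (hR : 0 < R) {x : E} (hxe : 0 ≤ ⟪e, x⟫)
    (hxR : ‖x‖ ≤ R) :
    w x ≤ M / R ^ 2 *
      (‖x‖ ^ 2 + (Module.finrank ℝ E + 1) * (R * ⟪e, x⟫ - ⟪e, x⟫ ^ 2)) := by
  set d : ℝ := (Module.finrank ℝ E : ℝ)
  have hd : 0 ≤ d := Nat.cast_nonneg _
  set K : ℝ := M / R ^ 2
  have hK : 0 < K := by positivity
  have hKR : K * R ^ 2 = M := by simp only [K]; field_simp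
  let g : E → ℝ := fun y => w y - K * (‖y‖ ^ 2 + (d + 1) * (R * ⟪e, y⟫ - ⟪e, y⟫ ^ 2))
  let S : Set E := Metric.closedBall 0 R ∩ {y | 0 ≤ ⟪e, y⟫}
  have hgc : Continuous g := by
    have := hw.continuous
    fun_prop
  have hS : IsCompact S :=
    (isCompact_closedBall 0 R).inter_right (isClosed_le (by fun_prop) (by fun_prop))
  have hxS : x ∈ S := ⟨by simpa using hxR, hxe⟩
  obtain ⟨p, ⟨hpR, hpe⟩, hp⟩ := hS.exists_isMaxOn ⟨x, hxS⟩ hgc.continuousOn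
  have hpR : ‖p‖ ≤ R := by simpa using hpR
  have hpe : 0 ≤ ⟪e, p⟫ := hpe
  have hep : ⟪e, p⟫ ≤ R := by
    have := real_inner_le_norm e p
    rw [he, one_mul] at this
    exact this.trans hpR
  have hnn : 0 ≤ (d + 1) * (R * ⟪e, p⟫ - ⟪e, p⟫ ^ 2) :=
    mul_nonneg (by linarith) (by nlinarith)
  suffices hgp : g p ≤ 0 by
    have : g x ≤ g p := hp hxS
    simp only [g] at this hgp
    linarith
  rcases hpR.eq_or_lt with hpR' | hpR'
  · have := mul_nonneg hK.le hnn
    have := hbd p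
    simp only [g, hpR']
    linarith
  rcases hpe.eq_or_lt with hpe' | hpe'
  · have := h0 p hpe'.symm
    have : 0 ≤ K * (‖p‖ ^ 2 + (d + 1) * (R * ⟪e, p⟫ - ⟪e, p⟫ ^ 2)) := by positivity
    simp only [g]
    linarith
  exfalso
  have hloc : IsLocalMax g p := by
    have hopen : IsOpen (Metric.ball (0 : E) R ∩ {y | 0 < ⟪e, y⟫}) :=
      Metric.isOpen_ball.inter (isOpen_lt (by fun_prop) (by fun_prop))
    filter_upwards [hopen.mem_nhds ⟨by simpa using hpR', hpe'⟩] with y hy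
    exact hp ⟨Metric.ball_subset_closedBall hy.1, show 0 ≤ ⟪e, y⟫ from le_of_lt hy.2⟩
  let b := stdOrthonormalBasis ℝ E
  have hsecond (v : E) :
      iteratedFDeriv ℝ 2 w p ![v, v] ≤ 2 * (K * (‖v‖ ^ 2 - (d + 1) * ⟪e, v⟫ ^ 2)) := by
    refine iteratedFDeriv_two_le_of_isLocalMax_line hw p v
      (K * (2 * ⟪p, v⟫ + (d + 1) * (R * ⟪e, v⟫ - 2 * ⟪e, p⟫ * ⟪e, v⟫))) _ ?_
    have hcont : Filter.Tendsto (fun t : ℝ => p + t • v) (𝓝 0) (𝓝 p) := by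
      have : Continuous fun t : ℝ => p + t • v := by fun_prop
      simpa using this.tendsto 0
    filter_upwards [hcont.eventually hloc] with t ht
    simp only [g, norm_add_sq_real, inner_add_right, inner_smul_right, norm_smul,
      Real.norm_eq_abs, mul_pow, sq_abs] at ht
    simp only [zero_smul, add_zero]
    linarith
  have hsum : ∑ i, ⟪e, b i⟫ ^ 2 = 1 := by
    simpa [he] using b.sum_sq_inner_left e
  have hle : Δ w p ≤ ∑ i, 2 * (K * (‖b i‖ ^ 2 - (d + 1) * ⟪e, b i⟫ ^ 2)) := by
    rw [laplacian_eq_iteratedFDeriv_orthonormalBasis w b]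
    exact Finset.sum_le_sum fun i _ => hsecond (b i)
  rw [hΔ, ← Finset.mul_sum, ← Finset.mul_sum, Finset.sum_sub_distrib, ← Finset.mul_sum, hsum] at hle
  simp only [OrthonormalBasis.norm_eq_one, one_pow, Finset.sum_const, Finset.card_univ,
    Fintype.card_fin, nsmul_eq_mul, mul_one] at hle
  change 0 ≤ 2 * (K * (d - (d + 1))) at hle
  linarith

/-- A harmonic function bounded above that vanishes on a hyperplane through the origin is nonpositive
on the positive side of that hyperplane. -/
theorem nonpos_of_laplacian_eq_zero_of_vanishing_hyperplane {w : E → ℝ} (hw : ContDiff ℝ 2 w)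
    (hΔ : ∀ x, Δ w x = 0) {M : ℝ} (hbd : ∀ x, w x ≤ M) {e : E} (he : ‖e‖ = 1)
    (h0 : ∀ x, ⟪e, x⟫ = 0 → w x = 0) {x : E} (hxe : 0 ≤ ⟪e, x⟫) : w x ≤ 0 := by
  set d : ℝ := (Module.finrank ℝ E : ℝ)
  set t := ⟪e, x⟫
  have hlim : Filter.Tendsto (fun R : ℝ => (|M| + 1) / R ^ 2 *
      (‖x‖ ^ 2 + (d + 1) * (R * t - t ^ 2))) Filter.atTop (𝓝 0) := by
    have h₁ : Filter.Tendsto (fun R : ℝ => R⁻¹) Filter.atTop (𝓝 0) := tendsto_inv_atTop_zero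
    have h₂ := ((h₁.pow 2).const_mul ((|M| + 1) * (‖x‖ ^ 2 - (d + 1) * t ^ 2))).add
      (h₁.const_mul ((|M| + 1) * ((d + 1) * t)))
    norm_num at h₂
    refine h₂.congr' ?_
    filter_upwards [Filter.eventually_gt_atTop 0] with R hR
    field_simp
    ring
  refine ge_of_tendsto hlim ?_
  filter_upwards [Filter.eventually_gt_atTop 0, Filter.eventually_ge_atTop ‖x‖] with R hR hxR
  exact le_barrier_of_laplacian_eq_zero hw hΔ (by positivity)
    (fun y => (hbd y).trans (by linarith [le_abs_self M])) he h0 hR hxe hxR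

/-- The Laplacian commutes with composition with affine isometries. -/
theorem laplacian_comp_add_linearIsometryEquiv {f : E → ℝ} (hf : ContDiff ℝ 2 f) (c : E)
    (σ : E ≃ₗᵢ[ℝ] E) (x : E) : Δ (fun z => f (c + σ z)) x = Δ f (c + σ x) := by
  let b := stdOrthonormalBasis ℝ E
  rw [laplacian_eq_iteratedFDeriv_orthonormalBasis _ b,
    laplacian_eq_iteratedFDeriv_orthonormalBasis f (b.map σ)]
  refine Finset.sum_congr rfl fun i _ => ?_
  have hfc : ContDiff ℝ 2 fun z => f (c + z) := by fun_prop
  have h := (σ : E →L[ℝ] E).iteratedFDeriv_comp_right hfc x (i := 2) le_rfl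
  rw [iteratedFDeriv_comp_add_left] at h
  have h' := congrArg (fun L => L ![b i, b i]) h
  refine h'.trans ?_
  simp only [ContinuousMultilinearMap.compContinuousLinearMap_apply]
  congr 1
  ext j
  fin_cases j <;> simp

/-- **Liouville's theorem**: a bounded harmonic function on a finite-dimensional Euclidean space is
constant. -/
theorem eq_of_laplacian_eq_zero_of_bounded {f : E → ℝ} (hf : ContDiff ℝ 2 f)
    (hΔ : ∀ x, Δ f x = 0) {M : ℝ} (hbd : ∀ x, |f x| ≤ M) (x y : E) : f x = f y := by
  suffices key : ∀ x y, f x ≤ f y from le_antisymm (key x y) (key y x)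
  intro x y
  rcases eq_or_ne x y with rfl | hxy
  · exact le_rfl
  have hne : ‖x - y‖ ≠ 0 := norm_ne_zero_iff.2 (sub_ne_zero.2 hxy)
  let e : E := ‖x - y‖⁻¹ • (x - y)
  let c : E := (2⁻¹ : ℝ) • (x + y)
  let z : E := (2⁻¹ : ℝ) • (x - y)
  let σ : E ≃ₗᵢ[ℝ] E := (ℝ ∙ e)ᗮ.reflection
  let w : E → ℝ := fun p => f (c + p) - f (c + σ p)
  have he : ‖e‖ = 1 := by simp [e, norm_smul, hne]
  have hf₁ : ContDiff ℝ 2 fun p => f (c + p) := by fun_prop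
  have hf₂ : ContDiff ℝ 2 fun p => f (c + σ p) := by
    have := σ.contDiff (n := 2)
    fun_prop
  have hwΔ (p : E) : Δ w p = 0 := by
    have h := hf₁.contDiffAt.laplacian_sub (x := p) hf₂.contDiffAt
    have h₁ := laplacian_comp_add_linearIsometryEquiv hf c (LinearIsometryEquiv.refl ℝ E) p
    have h₂ := laplacian_comp_add_linearIsometryEquiv hf c σ p
    simp only [LinearIsometryEquiv.coe_refl, id_eq] at h₁
    rw [h₁, h₂, hΔ, hΔ, sub_zero] at h
    exact h
  have hwb (p : E) : w p ≤ M + M := by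
    have h₁ := abs_le.1 (hbd (c + p))
    have h₂ := abs_le.1 (hbd (c + σ p))
    simp only [w]
    linarith
  have hw0 (p : E) (hp : ⟪e, p⟫ = 0) : w p = 0 := by
    have : σ p = p :=
      Submodule.reflection_mem_subspace_eq_self (Submodule.mem_orthogonal_singleton_iff_inner_right.2 hp)
    simp [w, this]
  have hez : 0 ≤ ⟪e, z⟫ := by
    simp only [e, z, inner_smul_left, inner_smul_right, real_inner_self_eq_norm_sq]
    simp only [conj_trivial]
    positivity
  have hσz : σ z = -z := by
    have : z = (‖x - y‖ / 2) • e := by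
      simp only [z, e, smul_smul]
      congr 1
      field_simp
    rw [this, map_smul, ← smul_neg]
    congr 1
    exact Submodule.reflection_orthogonalComplement_singleton_eq_neg e
  have h := nonpos_of_laplacian_eq_zero_of_vanishing_hyperplane (hf₁.sub hf₂) hwΔ hwb he hw0 hez
  have hx : c + z = x := by simp only [c, z]; module
  have hy : c + -z = y := by simp only [c, z]; module
  rw [hσz, hx, hy] at h
  linarith

/-- A Lipschitz function with vanishing Laplacian is affine. -/
theorem exists_eq_inner_add_of_laplacian_eq_zero_of_lipschitz {u : E → ℝ} (hu : ContDiff ℝ 2 u)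
    (hΔ : ∀ x, Δ u x = 0) {K : NNReal} (hL : LipschitzWith K u) :
    ∃ (a : E) (b : ℝ), ∀ x, u x = ⟪a, x⟫ + b := by
  have hconst (h x : E) : u (h + x) - u x = u h - u 0 := by
    have hs : ContDiff ℝ 2 fun x => u (h + x) := by fun_prop
    have hΔ' (p : E) : Δ (fun x => u (h + x) - u x) p = 0 := by
      have h₁ := laplacian_comp_add_linearIsometryEquiv hu h (LinearIsometryEquiv.refl ℝ E) p
      simp only [LinearIsometryEquiv.coe_refl, id_eq] at h₁
      have h₂ := hs.contDiffAt.laplacian_sub (x := p) hu.contDiffAt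
      rw [h₁, hΔ, hΔ, sub_zero] at h₂
      exact h₂
    have hb (p : E) : |u (h + p) - u p| ≤ K * ‖h‖ := by
      simpa [Real.dist_eq] using hL.dist_le_mul (h + p) p
    simpa using eq_of_laplacian_eq_zero_of_bounded (hs.sub hu) hΔ' hb x 0
  let φ : E →+ ℝ := AddMonoidHom.mk' (fun x => u x - u 0) fun x y => by
    linarith [hconst x y]
  let L : E →L[ℝ] ℝ := φ.toRealLinearMap (by
    have := hu.continuous
    exact this.sub continuous_const)
  refine ⟨(toDual ℝ E).symm L, u 0, fun x => ?_⟩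
  rw [toDual_symm_apply]
  change u x = u x - u 0 + u 0
  ring

end Liouville

section GraphEquations

variable {n : ℕ} {u : EuclideanSpace ℝ (Fin n) → ℝ}

theorem differentiable_gradient (hu : ContDiff ℝ 2 u) : Differentiable ℝ (gradient u) := by
  have hf' : Differentiable ℝ (fderiv ℝ u) :=
    (hu.fderiv_right (m := 1) (by norm_num)).differentiable (by norm_num)
  refine differentiable_euclidean.2 fun i => ?_
  have h : (fun y => gradient u y i) = fun y => fderiv ℝ u y (EuclideanSpace.single i 1) := by
    ext y
    simp [← inner_gradient_left, EuclideanSpace.inner_single_right]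
  rw [h]
  fun_prop

theorem laplacian_eq_vdiv_gradient (hu : ContDiff ℝ 2 u) (x : EuclideanSpace ℝ (Fin n)) :
    Δ u x = vdiv (gradient u) x := by
  rw [laplacian_eq_iteratedFDeriv_orthonormalBasis u (EuclideanSpace.basisFun (Fin n) ℝ)]
  refine Finset.sum_congr rfl fun i _ => ?_
  have hf' : Differentiable ℝ (fderiv ℝ u) :=
    (hu.fderiv_right (m := 1) (by norm_num)).differentiable (by norm_num)
  set e : EuclideanSpace ℝ (Fin n) := EuclideanSpace.single i 1
  have h₁ := ((hf' x).hasFDerivAt.clm_apply (hasFDerivAt_const e x)).fderiv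
  have h₂ := ((differentiable_gradient hu x).hasFDerivAt.inner ℝ (hasFDerivAt_const e x)).fderiv
  simp only [inner_gradient_left] at h₂
  have h := congrArg (fun L => L e) (h₁.symm.trans h₂)
  simpa [iteratedFDeriv_two_apply, fderivInnerCLM_apply, e] using h

/-- Expanded form of `div (G / √(1 + c|G|²)) = 0`. -/
theorem vdiv_inv_sqrt_smul_eq_zero {G : EuclideanSpace ℝ (Fin n) → EuclideanSpace ℝ (Fin n)}
    {x : EuclideanSpace ℝ (Fin n)} (hG : DifferentiableAt ℝ G x) (c : ℝ)
    (hpos : 0 < 1 + c * ‖G x‖ ^ 2)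
    (hdiv : vdiv (fun y => (Real.sqrt (1 + c * ‖G y‖ ^ 2))⁻¹ • G y) x = 0) :
    (1 + c * ‖G x‖ ^ 2) * vdiv G x = c * ⟪fderiv ℝ G x (G x), G x⟫ := by
  set s := Real.sqrt (1 + c * ‖G x‖ ^ 2) with hs
  have hs0 : 0 < s := Real.sqrt_pos.2 hpos
  have hs2 : s ^ 2 = 1 + c * ‖G x‖ ^ 2 := Real.sq_sqrt hpos.le
  set L := fderiv ℝ G x
  have hL : HasFDerivAt G L x := hG.hasFDerivAt
  have hsqrt := ((hL.norm_sq.const_mul c).const_add 1).sqrt hpos.ne'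
  have hinv := (hasDerivAt_inv hs0.ne').comp_hasFDerivAt x hsqrt
  have hF := (hinv.smul hL).fderiv
  have hsum : ∑ i, ⟪G x, L (EuclideanSpace.single i 1)⟫ * G x i = ⟪L (G x), G x⟫ := by
    have hx := (EuclideanSpace.basisFun (Fin n) ℝ).sum_repr (G x)
    conv_rhs => rw [← hx, map_sum, sum_inner, hx]
    refine Finset.sum_congr rfl fun i _ => ?_
    simp [inner_smul_left, real_inner_comm, mul_comm]
  unfold vdiv at hdiv ⊢
  change ∑ i, ⟪fderiv ℝ (((fun y => y⁻¹) ∘ fun y => Real.sqrt (1 + c * ‖G y‖ ^ 2)) • G) x _, _⟫ = 0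
    at hdiv
  rw [hF] at hdiv
  rw [← hsum]
  rw [← sub_eq_zero, ← hs2, Finset.mul_sum, Finset.mul_sum, ← Finset.sum_sub_distrib,
    ← mul_zero (s ^ 3), ← hdiv, Finset.mul_sum]
  refine Finset.sum_congr rfl fun i _ => ?_
  simp [← hs, inner_add_left, inner_smul_left, EuclideanSpace.inner_single_right]
  field_simp
  ring

end GraphEquations

/-- Calabi–Bernstein type theorem: an entire graph which is simultaneously
minimal in ℝ^{n+1} and maximal in 𝕃^{n+1} is a spacelike hyperplane. -/
theorem entire_minimal_maximal_is_hyperplane {n : ℕ} (hn : 2 ≤ n)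
    (u : EuclideanSpace ℝ (Fin n) → ℝ) (hu : ContDiff ℝ (⊤ : ℕ∞) u)
    (hsp : ∀ x, ‖gradient u x‖ < 1)
    (hmin : ∀ x,
      vdiv (fun y => (Real.sqrt (1 + ‖gradient u y‖ ^ 2))⁻¹ • gradient u y) x = 0)
    (hmax : ∀ x,
      vdiv (fun y => (Real.sqrt (1 - ‖gradient u y‖ ^ 2))⁻¹ • gradient u y) x = 0) :
    ∃ (a : EuclideanSpace ℝ (Fin n)) (b : ℝ), ‖a‖ < 1 ∧
      ∀ x, u x = ⟪a, x⟫ + b := by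
  have hu2 : ContDiff ℝ 2 u := hu.of_le (WithTop.coe_le_coe.2 le_top)
  have hdiff : Differentiable ℝ u := hu2.differentiable (by norm_num)
  have hG := differentiable_gradient hu2
  have hΔ (x : EuclideanSpace ℝ (Fin n)) : Laplacian.laplacian u x = 0 := by
    have hlt : ‖gradient u x‖ ^ 2 < 1 := by
      have := hsp x
      nlinarith [norm_nonneg (gradient u x)]
    have h₁ := vdiv_inv_sqrt_smul_eq_zero (hG x) 1 (by positivity) (by simpa using hmin x)
    have h₂ := vdiv_inv_sqrt_smul_eq_zero (hG x) (-1) (by linarith)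
      (by simpa [← sub_eq_add_neg] using hmax x)
    rw [laplacian_eq_vdiv_gradient hu2]
    linarith
  have hL : LipschitzWith 1 u := lipschitzWith_of_nnnorm_fderiv_le hdiff fun x => by
    rw [← toDual_gradient, LinearIsometryEquiv.nnnorm_map]
    exact_mod_cast (hsp x).le
  obtain ⟨a, b, hab⟩ := exists_eq_inner_add_of_laplacian_eq_zero_of_lipschitz hu2 hΔ hL
  refine ⟨a, b, ?_, hab⟩
  have ha : HasGradientAt u a 0 := by
    rw [hasGradientAt_iff_hasFDerivAt, funext hab]
    exact ((toDual ℝ _ a).hasFDerivAt).add_const b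
  rw [← ha.gradient]
  exact hsp 0
end

section
/- Fix n ≥ 2 and a > 0, and let Ω = {x ∈ ℝⁿ : x₁ > 0 and x₁² + x₂² > a²}. Define u : Ω → ℝ by u(x) = a · arctan(x₂/x₁) (a generalized helicoid, depending only on the first two coordinates). Then |Du(x)| = a/√(x₁² + x₂²) < 1 on Ω, and u satisfies simultaneously div(Du/√(1+|Du|²)) = 0 and div(Du/√(1−|Du|²)) = 0 on Ω; that is, the graph of u is a non-planar spacelike hypersurface that is simultaneously minimal in ℝ^{n+1} and maximal in 𝕃^{n+1}. -/
open scoped RealInnerProductSpace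

/-- The infinitesimal rotation `y ↦ yᵢ eⱼ - yⱼ eᵢ` in the `(i, j)` coordinate plane. -/
noncomputable def planeRotation {n : ℕ} (i j : Fin n) :
    EuclideanSpace ℝ (Fin n) →L[ℝ] EuclideanSpace ℝ (Fin n) :=
  (EuclideanSpace.proj i : EuclideanSpace ℝ (Fin n) →L[ℝ] ℝ).smulRight
      (EuclideanSpace.single j (1 : ℝ)) -
    (EuclideanSpace.proj j : EuclideanSpace ℝ (Fin n) →L[ℝ] ℝ).smulRight
      (EuclideanSpace.single i (1 : ℝ))

theorem planeRotation_apply {n : ℕ} (i j : Fin n) (y : EuclideanSpace ℝ (Fin n)) :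
    planeRotation i j y =
      y i • EuclideanSpace.single j (1 : ℝ) - y j • EuclideanSpace.single i (1 : ℝ) :=
  rfl

theorem norm_planeRotation_sq {n : ℕ} {i j : Fin n} (hij : i ≠ j)
    (y : EuclideanSpace ℝ (Fin n)) :
    ‖planeRotation i j y‖ ^ 2 = y i ^ 2 + y j ^ 2 := by
  rw [planeRotation_apply, @norm_sub_sq_real]
  simp [norm_smul, inner_smul_left, inner_smul_right, EuclideanSpace.inner_single_left, hij]

theorem hasFDerivAt_sq_add_sq {n : ℕ} (i j : Fin n) (x : EuclideanSpace ℝ (Fin n)) :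
    HasFDerivAt (fun y : EuclideanSpace ℝ (Fin n) => y i ^ 2 + y j ^ 2)
      ((2 * x i) • (EuclideanSpace.proj i : EuclideanSpace ℝ (Fin n) →L[ℝ] ℝ) +
        (2 * x j) • (EuclideanSpace.proj j : EuclideanSpace ℝ (Fin n) →L[ℝ] ℝ)) x := by
  have h (k : Fin n) : HasFDerivAt (fun y : EuclideanSpace ℝ (Fin n) => y k ^ 2)
      ((2 * x k) • (EuclideanSpace.proj k : EuclideanSpace ℝ (Fin n) →L[ℝ] ℝ)) x := by
    simpa using
      (EuclideanSpace.proj k : EuclideanSpace ℝ (Fin n) →L[ℝ] ℝ).hasFDerivAt.pow 2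
  exact (h i).add (h j)

/-- A rotation field scaled by a function of the distance to its axis is divergence free. -/
theorem vdiv_smul_planeRotation {n : ℕ} {i j : Fin n} (hij : i ≠ j) {φ : ℝ → ℝ}
    {x : EuclideanSpace ℝ (Fin n)} (hφ : DifferentiableAt ℝ φ (x i ^ 2 + x j ^ 2)) :
    vdiv (fun y => φ (y i ^ 2 + y j ^ 2) • planeRotation i j y) x = 0 := by
  have h := (hφ.hasDerivAt.comp_hasFDerivAt x (hasFDerivAt_sq_add_sq i j x)).smul
    (planeRotation i j).hasFDerivAt
  have h' : fderiv ℝ (fun y => φ (y i ^ 2 + y j ^ 2) • planeRotation i j y) x = _ := h.fderiv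
  have hdiv (k : Fin n) : (planeRotation i j (EuclideanSpace.single k 1)) k = 0 := by
    by_cases hi : k = i <;> by_cases hj : k = j <;> simp_all [planeRotation_apply]
  unfold vdiv
  rw [h']
  simp only [EuclideanSpace.inner_single_right, add_apply,
    smul_apply, ContinuousLinearMap.smulRight_apply, PiLp.add_apply,
    PiLp.smul_apply, hdiv]
  simp [planeRotation_apply, add_mul, mul_add, mul_sub, hij, hij.symm,
    Finset.sum_sub_distrib]
  ring

theorem gradient_arctan_div {n : ℕ} (a : ℝ) (i j : Fin n) {x : EuclideanSpace ℝ (Fin n)}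
    (hx : 0 < x i) :
    gradient (fun y : EuclideanSpace ℝ (Fin n) => a * Real.arctan (y j / y i)) x =
      (a / (x i ^ 2 + x j ^ 2)) • planeRotation i j x := by
  apply HasGradientAt.gradient
  rw [hasGradientAt_iff_hasFDerivAt]
  have h (k : Fin n) : HasFDerivAt (fun y : EuclideanSpace ℝ (Fin n) => y k)
      (EuclideanSpace.proj k : EuclideanSpace ℝ (Fin n) →L[ℝ] ℝ) x :=
    (EuclideanSpace.proj k : EuclideanSpace ℝ (Fin n) →L[ℝ] ℝ).hasFDerivAt
  have hs : x i ^ 2 + x j ^ 2 ≠ 0 := by positivity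
  have hinv := (hasDerivAt_inv hx.ne').comp_hasFDerivAt x (h i)
  have hdiv := (h j).fun_mul hinv
  simp only [Function.comp_def, ← div_eq_mul_inv] at hdiv
  refine (hdiv.arctan.const_mul a).congr_fderiv ?_
  ext v
  simp [planeRotation_apply, EuclideanSpace.inner_single_left]
  field_simp
  ring

theorem norm_gradient_arctan_div {n : ℕ} {a : ℝ} (ha : 0 < a) {i j : Fin n} (hij : i ≠ j)
    {x : EuclideanSpace ℝ (Fin n)} (hx : 0 < x i) :
    ‖gradient (fun y : EuclideanSpace ℝ (Fin n) => a * Real.arctan (y j / y i)) x‖ =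
      a / Real.sqrt (x i ^ 2 + x j ^ 2) := by
  have hs : 0 < x i ^ 2 + x j ^ 2 := by positivity
  have hr : ‖planeRotation i j x‖ = Real.sqrt (x i ^ 2 + x j ^ 2) := by
    rw [← norm_planeRotation_sq hij, Real.sqrt_sq (norm_nonneg _)]
  rw [gradient_arctan_div a i j hx, norm_smul, hr, Real.norm_of_nonneg (by positivity)]
  have hq := Real.sq_sqrt hs.le
  have hp := Real.sqrt_pos.2 hs
  rw [div_mul_eq_mul_div, div_eq_div_iff hs.ne' hp.ne', mul_assoc, ← sq, hq]

theorem vdiv_normalized_gradient_arctan_div {n : ℕ} {a : ℝ} (ha : 0 < a) {i j : Fin n}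
    (hij : i ≠ j) (ε : ℝ) {x : EuclideanSpace ℝ (Fin n)} (hx : 0 < x i)
    (hε : 0 < 1 + ε * (a ^ 2 / (x i ^ 2 + x j ^ 2))) :
    vdiv (fun y => (Real.sqrt (1 + ε *
        ‖gradient (fun y : EuclideanSpace ℝ (Fin n) => a * Real.arctan (y j / y i)) y‖ ^ 2))⁻¹ •
      gradient (fun y : EuclideanSpace ℝ (Fin n) => a * Real.arctan (y j / y i)) y) x = 0 := by
  have hs : x i ^ 2 + x j ^ 2 ≠ 0 := by positivity
  have hφ : DifferentiableAt ℝ (fun s => (Real.sqrt (1 + ε * (a ^ 2 / s)))⁻¹ * (a / s))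
      (x i ^ 2 + x j ^ 2) := by
    have hq : Real.sqrt (1 + ε * (a ^ 2 / (x i ^ 2 + x j ^ 2))) ≠ 0 := (Real.sqrt_pos.2 hε).ne'
    have hd (c : ℝ) : DifferentiableAt ℝ (fun s => c / s) (x i ^ 2 + x j ^ 2) :=
      (differentiableAt_const c).div differentiableAt_id hs
    exact ((((hd (a ^ 2)).const_mul ε).const_add 1).sqrt hε.ne').inv hq |>.mul (hd a)
  rw [← vdiv_smul_planeRotation hij hφ]
  have hev : ∀ᶠ y : EuclideanSpace ℝ (Fin n) in nhds x, 0 < y i :=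
    (EuclideanSpace.proj i : EuclideanSpace ℝ (Fin n) →L[ℝ] ℝ).continuous.continuousAt.eventually
      (lt_mem_nhds hx)
  unfold vdiv
  rw [Filter.EventuallyEq.fderiv_eq]
  filter_upwards [hev] with y hy
  have hsy : 0 ≤ y i ^ 2 + y j ^ 2 := by positivity
  rw [norm_gradient_arctan_div ha hij hy, gradient_arctan_div a i j hy, smul_smul, div_pow,
    Real.sq_sqrt hsy]

theorem arctan_div_not_affine {n : ℕ} {a : ℝ} (ha : 0 < a) {i j : Fin n} (hij : i ≠ j) :
    ¬ ∃ (p : EuclideanSpace ℝ (Fin n)) (b : ℝ), ∀ x : EuclideanSpace ℝ (Fin n),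
      0 < x i ∧ a ^ 2 < x i ^ 2 + x j ^ 2 →
        a * Real.arctan (x j / x i) = ⟪p, x⟫ + b := by
  rintro ⟨p, b, h⟩
  have ha2 := pow_pos ha 2
  have haxis (t : ℝ) (ht : 1 < t) : 0 = t * a * p i + b := by
    have := h ((t * a) • EuclideanSpace.single i 1) ⟨by simp; positivity, by
      simp [hij.symm, mul_pow]; exact lt_mul_left ha2 (by nlinarith)⟩
    simpa [hij.symm, inner_smul_right, EuclideanSpace.inner_single_right] using this
  have hdiag (t : ℝ) (ht : 1 ≤ t) : a * (Real.pi / 4) = t * a * (p i + p j) + b := by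
    have hta : t * a ≠ 0 := by positivity
    have := h ((t * a) • (EuclideanSpace.single i 1 + EuclideanSpace.single j 1))
      ⟨by simp [hij]; positivity, by simp [hij, hij.symm, mul_pow]; nlinarith [one_le_pow₀ ht (n := 2)]⟩
    simpa [hij, hij.symm, inner_smul_right, inner_add_right, EuclideanSpace.inner_single_right,
      hta, Real.arctan_one, mul_add] using this
  nlinarith [haxis 2 (by norm_num), haxis 3 (by norm_num), hdiag 1 le_rfl,
    hdiag 2 (by norm_num), mul_pos ha Real.pi_pos]

/-- The generalized helicoid u(x) = a·arctan(x₂/x₁) on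
Ω = {x₁ > 0, x₁² + x₂² > a²} is a non-planar spacelike graph which is
simultaneously minimal in ℝ^{n+1} and maximal in 𝕃^{n+1}. -/
theorem generalized_helicoid_minimal_maximal {n : ℕ} (hn : 2 ≤ n)
    (a : ℝ) (ha : 0 < a)
    (Ω : Set (EuclideanSpace ℝ (Fin n)))
    (hΩ : Ω = {x | 0 < x ⟨0, by omega⟩ ∧
      a ^ 2 < x ⟨0, by omega⟩ ^ 2 + x ⟨1, by omega⟩ ^ 2})
    (u : EuclideanSpace ℝ (Fin n) → ℝ)
    (hu : ∀ x, u x = a * Real.arctan (x ⟨1, by omega⟩ / x ⟨0, by omega⟩)) :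
    (∀ x ∈ Ω, ‖gradient u x‖ =
        a / Real.sqrt (x ⟨0, by omega⟩ ^ 2 + x ⟨1, by omega⟩ ^ 2) ∧
      ‖gradient u x‖ < 1) ∧
    (∀ x ∈ Ω,
      vdiv (fun y => (Real.sqrt (1 + ‖gradient u y‖ ^ 2))⁻¹ • gradient u y) x = 0) ∧
    (∀ x ∈ Ω,
      vdiv (fun y => (Real.sqrt (1 - ‖gradient u y‖ ^ 2))⁻¹ • gradient u y) x = 0) ∧
    ¬ ∃ (p : EuclideanSpace ℝ (Fin n)) (b : ℝ), ∀ x ∈ Ω, u x = ⟪p, x⟫ + b := by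
  obtain rfl : u = fun x => a * Real.arctan (x ⟨1, by omega⟩ / x ⟨0, by omega⟩) := funext hu
  subst hΩ
  have hij : (⟨0, by omega⟩ : Fin n) ≠ ⟨1, by omega⟩ := by simp
  have hbound {x : EuclideanSpace ℝ (Fin n)}
      (hx : 0 < x ⟨0, by omega⟩ ∧ a ^ 2 < x ⟨0, by omega⟩ ^ 2 + x ⟨1, by omega⟩ ^ 2) :
      a ^ 2 / (x ⟨0, by omega⟩ ^ 2 + x ⟨1, by omega⟩ ^ 2) < 1 :=
    (div_lt_one ((by positivity : 0 < a ^ 2).trans hx.2)).2 hx.2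
  refine ⟨fun x hx => ?_, fun x hx => ?_, fun x hx => ?_, arctan_div_not_affine ha hij⟩
  · have hnorm := norm_gradient_arctan_div ha hij hx.1
    refine ⟨hnorm, hnorm.trans_lt ?_⟩
    have hlt := Real.lt_sqrt_of_sq_lt hx.2
    exact (div_lt_one (ha.trans hlt)).2 hlt
  · simpa only [one_mul] using vdiv_normalized_gradient_arctan_div ha hij 1 hx.1 (by positivity)
  · simpa only [neg_one_mul, ← sub_eq_add_neg] using
      vdiv_normalized_gradient_arctan_div ha hij (-1) hx.1 (by linarith [hbound hx])
end
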